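/- Let H be a complex Hilbert space and A a bounded self-adjoint operator on H. Let r > 0 and λ ∈ σ(A) be such that every μ ∈ σ(A) with μ ≠ λ satisfies |λ − μ| ≥ 2r, and let λ_N ∈ ℝ satisfy |λ − λ_N| ≤ r/2. Let P be the Riesz projection of A over the circle of radius r centered at λ. Then for every ψ ∈ H one has ‖ψ − Pψ‖ ≤ (2/r)·‖Aψ − λ_N·ψ‖. Moreover, if ‖ψ‖ = 1 and (2/r)·‖Aψ − λ_N·ψ‖ < 1, then Pψ ≠ 0. -/

import Mathlib

/-- The Riesz projection of a bounded operator `A` over the positively oriented circle of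
radius `R` centered at `c`: `(2πi)⁻¹ ∮_{|z-c|=R} (z•I - A)⁻¹ dz`, where the inverse is
interpreted as `0` at points where `z•I - A` is not invertible. -/
noncomputable def rieszProjection {H : Type*} [NormedAddCommGroup H] [InnerProductSpace ℂ H]
    [CompleteSpace H] (A : H →L[ℂ] H) (c : ℂ) (R : ℝ) : H →L[ℂ] H :=
  (2 * Real.pi * Complex.I : ℂ)⁻¹ • ∮ z in C(c, R), Ring.inverse (z • (1 : H →L[ℂ] H) - A)

open Filter Topology in
lemma contOn_ite_isolated (S : Set ℂ) (l : ℂ) (d : ℝ) (hd : 0 < d)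
    (hsep : ∀ μ ∈ S, μ ≠ l → d ≤ ‖l - μ‖) (a : ℂ) (h : ℂ → ℂ)
    (hh : ∀ x ∈ S, x ≠ l → ContinuousAt h x) :
    ContinuousOn (fun x => if x = l then a else h x) S := by
  intro x hx
  by_cases hxl : x = l
  · subst hxl
    have : (fun y => if y = x then a else h y) =ᶠ[𝓝[S] x] fun _ => a := by
      filter_upwards [self_mem_nhdsWithin, mem_nhdsWithin_of_mem_nhds (Metric.ball_mem_nhds x hd)]
        with y hy hyb
      by_cases hyx : y = x
      · simp [hyx]
      · have h1 := hsep y hy hyx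
        rw [Metric.mem_ball, dist_eq_norm, norm_sub_rev] at hyb
        linarith
    exact continuousWithinAt_const.congr_of_eventuallyEq this (by simp)
  · have : (fun y => if y = l then a else h y) =ᶠ[𝓝[S] x] h := by
      filter_upwards [mem_nhdsWithin_of_mem_nhds (isOpen_ne.mem_nhds hxl)] with y hy
      simp [show y ≠ l from hy]
    exact (hh x hx hxl).continuousWithinAt.congr_of_eventuallyEq this (by simp [hxl])

lemma scalar_circle (l : ℂ) (r : ℝ) (hr : 0 < r) (x : ℂ) (hx : x ≠ l → 2 * r ≤ ‖l - x‖) :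
    (∮ z in C(l, r), (z - x)⁻¹) = (2 * Real.pi * Complex.I : ℂ) * (if x = l then 1 else 0) := by
  by_cases h : x = l
  · rw [circleIntegral.integral_sub_inv_of_mem_ball (by simp [h, hr])]
    simp [h]
  · have h2 := hx h
    simp only [h, if_false, mul_zero]
    have hne : ∀ z ∈ Metric.closedBall l r, z - x ≠ 0 := by
      intro z hz h0
      rw [sub_eq_zero.mp h0, Metric.mem_closedBall, dist_eq_norm, norm_sub_rev] at hz
      linarith
    apply Complex.circleIntegral_eq_zero_of_differentiable_on_off_countable hr.le
      Set.countable_empty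
    · exact ContinuousOn.inv₀ (by fun_prop) hne
    · intro z hz
      exact DifferentiableAt.inv (by fun_prop) (hne z (Metric.ball_subset_closedBall hz.1))

lemma riesz_eq_cfc {H : Type*} [NormedAddCommGroup H] [InnerProductSpace ℂ H] [CompleteSpace H]
    (A : H →L[ℂ] H) (hA : IsStarNormal A) (r : ℝ) (hr : 0 < r)
    (l : ℂ) (hsep : ∀ μ ∈ spectrum ℂ A, μ ≠ l → 2 * r ≤ ‖l - μ‖) :
    rieszProjection A l r = cfc (fun x : ℂ => if x = l then 1 else 0) A := by
  have hdist : ∀ θ : ℝ, ∀ x ∈ spectrum ℂ A, r ≤ ‖circleMap l r θ - x‖ := by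
    intro θ x hx
    have h1 : ‖circleMap l r θ - l‖ = r := by simp [circleMap, abs_of_pos hr]
    by_cases h : x = l
    · rw [h, h1]
    · have h2 := hsep x hx h
      have h3 : ‖l - x‖ ≤ ‖l - circleMap l r θ‖ + ‖circleMap l r θ - x‖ :=
        norm_sub_le_norm_sub_add_norm_sub ..
      rw [norm_sub_rev l (circleMap l r θ)] at h3
      linarith
  have hne : ∀ θ : ℝ, ∀ x ∈ spectrum ℂ A, circleMap l r θ - x ≠ 0 := by
    intro θ x hx h
    have := hdist θ x hx
    rw [h, norm_zero] at this
    linarith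
  have hinv : ∀ θ : ℝ, deriv (circleMap l r) θ • Ring.inverse (circleMap l r θ • (1 : H →L[ℂ] H) - A)
      = cfc (fun x : ℂ => deriv (circleMap l r) θ * (circleMap l r θ - x)⁻¹) A := by
    intro θ
    rw [cfc_const_mul _ (fun x : ℂ => (circleMap l r θ - x)⁻¹) A
      (ContinuousOn.inv₀ (by fun_prop) (hne θ)), cfc_inv (fun x => circleMap l r θ - x) A (hne θ),
      cfc_sub (fun _ => circleMap l r θ) (fun x => x) A, cfc_const _ A, cfc_id' ℂ A,
      Algebra.algebraMap_eq_smul_one]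
  have key := cfc_setIntegral (μ := MeasureTheory.volume) (𝕜 := ℂ) (s := Set.Icc 0 (2 * Real.pi))
    measurableSet_Icc
    (fun (θ : ℝ) (x : ℂ) => deriv (circleMap l r) θ * (circleMap l r θ - x)⁻¹) (fun _ => 1) A
    (by
      simp only [deriv_circleMap]
      refine ContinuousOn.mul (by fun_prop) (ContinuousOn.inv₀ (by fun_prop) ?_)
      rintro ⟨θ, x⟩ ⟨_, hx⟩
      exact hne θ x hx)
    (by
      refine Filter.Eventually.of_forall fun θ x hx => ?_
      have := hdist θ x hx
      have h1 : ‖deriv (circleMap l r) θ‖ = r := by simp [abs_of_pos hr]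
      rw [norm_mul, norm_inv, h1, ← div_eq_mul_inv]
      exact div_le_one_of_le₀ this (norm_nonneg _))
    (MeasureTheory.integrable_const (1:ℝ)).2
  rw [rieszProjection, circleIntegral_def_Icc]
  simp only [hinv]
  rw [← key]
  have hc : (2 * Real.pi * Complex.I : ℂ) ≠ 0 := by simp [Real.pi_ne_zero]
  have hcont := contOn_ite_isolated (spectrum ℂ A) l (2 * r) (by linarith) hsep 1 (fun _ => 0)
    (fun _ _ _ => continuousAt_const)
  rw [cfc_congr (g := fun x => (2 * Real.pi * Complex.I : ℂ) * (if x = l then 1 else 0)),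
    cfc_const_mul _ _ A hcont, smul_smul, inv_mul_cancel₀ hc, one_smul]
  intro x hx
  have := scalar_circle l r hr x (hsep x hx)
  rw [circleIntegral_def_Icc] at this
  exact this

theorem stmt4 {H : Type*} [NormedAddCommGroup H] [InnerProductSpace ℂ H] [CompleteSpace H]
    (A : H →L[ℂ] H) (hA : IsSelfAdjoint A) (r : ℝ) (hr : 0 < r)
    (lam : ℝ) (hlam : (lam : ℂ) ∈ spectrum ℂ A)
    (hsep : ∀ μ ∈ spectrum ℂ A, μ ≠ (lam : ℂ) → 2 * r ≤ ‖(lam : ℂ) - μ‖)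
    (lamN : ℝ) (hclose : |lam - lamN| ≤ r / 2) :
    (∀ ψ : H, ‖ψ - rieszProjection A (lam : ℂ) r ψ‖ ≤ (2 / r) * ‖A ψ - (lamN : ℂ) • ψ‖) ∧
    (∀ ψ : H, ‖ψ‖ = 1 → (2 / r) * ‖A ψ - (lamN : ℂ) • ψ‖ < 1 →
      rieszProjection A (lam : ℂ) r ψ ≠ 0) := by
  have hN : IsStarNormal A := hA.isStarNormal
  have main : ∀ ψ : H, ‖ψ - rieszProjection A (lam : ℂ) r ψ‖
      ≤ (2 / r) * ‖A ψ - (lamN : ℂ) • ψ‖ := by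
    have hfar : ∀ x ∈ spectrum ℂ A, x ≠ (lam : ℂ) → r / 2 ≤ ‖x - lamN‖ := by
      intro x hx h
      have h2 := hsep x hx h
      have h3 : ‖(lam : ℂ) - x‖ ≤ ‖(lam : ℂ) - lamN‖ + ‖(lamN : ℂ) - x‖ :=
        norm_sub_le_norm_sub_add_norm_sub ..
      have h4 : ‖(lam : ℂ) - lamN‖ = |lam - lamN| := by
        rw [← Complex.ofReal_sub, Complex.norm_real, Real.norm_eq_abs]
      rw [norm_sub_rev (lamN : ℂ)] at h3
      linarith
    have hfar0 : ∀ x ∈ spectrum ℂ A, x ≠ (lam : ℂ) → x - (lamN : ℂ) ≠ 0 := by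
      intro x hx h h0
      have := hfar x hx h
      rw [h0, norm_zero] at this
      linarith
    have hc1 := contOn_ite_isolated (spectrum ℂ A) lam (2 * r) (by linarith) hsep 1 (fun _ => 0)
      (fun _ _ _ => continuousAt_const)
    have hc2 := contOn_ite_isolated (spectrum ℂ A) lam (2 * r) (by linarith) hsep 0
      (fun x => (x - (lamN : ℂ))⁻¹)
      (fun x hx h => ContinuousAt.inv₀ (by fun_prop) (hfar0 x hx h))
    set G := cfc (fun x : ℂ => if x = (lam : ℂ) then 0 else (x - (lamN : ℂ))⁻¹) A with hG
    have hGn : ‖G‖ ≤ 2 / r := by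
      refine norm_cfc_le (by positivity) fun x hx => ?_
      by_cases h : x = (lam : ℂ)
      · simp only [h, if_true, norm_zero]; positivity
      · simp only [h, if_false, norm_inv]
        rw [show 2 / r = (r / 2)⁻¹ by rw [inv_div]]
        exact inv_anti₀ (by positivity) (hfar x hx h)
    have hop : 1 - rieszProjection A (lam : ℂ) r = G * (A - (lamN : ℂ) • 1) := by
      have e1 : A - (lamN : ℂ) • 1 = cfc (fun x : ℂ => x - (lamN : ℂ)) A := by
        rw [cfc_sub (fun x => x) (fun _ => (lamN : ℂ)) A, cfc_const _ A, cfc_id' ℂ A,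
          Algebra.algebraMap_eq_smul_one]
      rw [riesz_eq_cfc A hN r hr _ hsep, e1, hG, ← cfc_mul _ _ A hc2 (by fun_prop),
        ← cfc_const_one ℂ A, ← cfc_sub _ _ A (by fun_prop) hc1]
      apply cfc_congr
      intro x hx
      by_cases h : x = (lam : ℂ)
      · simp [h]
      · simp [h, hfar0 x hx h]
    intro ψ
    have e := congrArg (fun T : H →L[ℂ] H => T ψ) hop
    simp only [ContinuousLinearMap.sub_apply, ContinuousLinearMap.mul_apply',
      ContinuousLinearMap.one_apply, ContinuousLinearMap.smul_apply] at e
    rw [e]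
    exact G.le_of_opNorm_le hGn _
  refine ⟨main, fun ψ h1 h2 h0 => ?_⟩
  have := main ψ
  rw [h0, sub_zero, h1] at this
  linarith
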